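/- arXiv:2207.06342 — 4 statements merged into one kernel-verified Lean document; each statement's English description precedes it below -/
import Mathlib

section
/- Correctness of the randomized SVD jackknife core matrices (Algorithm 3.1, line 11): let A ∈ 𝕂^{d₁×d₂} and let Y ∈ 𝕂^{d₁×s} have full column rank with economy QR factorization Y = QR (Q ∈ 𝕂^{d₁×s} with orthonormal columns, R ∈ 𝕂^{s×s} upper triangular invertible). Let C := Q*A have economy singular value decomposition C = Ũ Σ V* with Ũ ∈ 𝕂^{s×s} unitary, Σ ∈ ℝ^{s×s} diagonal, and V ∈ 𝕂^{d₂×s} with orthonormal columns, and set U := QŨ. Fix j, let R' ∈ 𝕂^{s×(s-1)} be R with its j-th column deleted, and let R' = Q̃ R̃ be an economy QR factorization with Q̃ ∈ 𝕂^{s×(s-1)} having orthonormal columns and R̃ invertible. Then the orthogonal projection of A onto the range of Y^{(j)} (Y with its j-th column deleted) equals U T_j V*, where T_j := Ũ* Q̃ Q̃* Ũ Σ. -/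
open Matrix

/-- **Correctness of the randomized SVD jackknife core matrices** (Algorithm 3.1, line 11).
Let `A ∈ 𝕂^{d₁×d₂}` and let `Y ∈ 𝕂^{d₁×s}` (here `s = n+1`) have economy QR factorization
`Y = Q R` with `Q` having orthonormal columns and `R` upper triangular and invertible (so `Y`
has full column rank).  Let `C := Q* A` have economy SVD `C = Ũ Σ V*` with `Ũ ∈ 𝕂^{s×s}`
unitary, `Σ` diagonal with real entries, and `V ∈ 𝕂^{d₂×s}` with orthonormal columns; set
`U := Q Ũ`.  Fix `j`, let `R'` be `R` with its `j`-th column deleted, with economy QR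
factorization `R' = Q̃ R̃` (`Q̃ ∈ 𝕂^{s×(s−1)}` with orthonormal columns, `R̃` invertible).
Then the orthogonal projection of `A` onto the range of `Y⁽ʲ⁾` (`Y` with its `j`-th column
deleted), i.e. `P A` for the Hermitian idempotent `P` with `range P = range Y⁽ʲ⁾`, equals
`U T_j V*` where `T_j := Ũ* Q̃ Q̃* Ũ Σ`. -/
theorem randomized_svd_core_matrix_correct
    {𝕂 : Type*} [RCLike 𝕂] {d₁ d₂ n : ℕ}
    (A : Matrix (Fin d₁) (Fin d₂) 𝕂)
    (Y Q : Matrix (Fin d₁) (Fin (n + 1)) 𝕂) (R : Matrix (Fin (n + 1)) (Fin (n + 1)) 𝕂)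
    (hYQR : Y = Q * R) (hQ : Qᴴ * Q = 1)
    (hRtri : R.BlockTriangular id) (hRinv : IsUnit R.det)
    (Ut : Matrix (Fin (n + 1)) (Fin (n + 1)) 𝕂) (hUt : Utᴴ * Ut = 1)
    (S : Matrix (Fin (n + 1)) (Fin (n + 1)) 𝕂) (hSdiag : S.IsDiag)
    (hSreal : ∀ i, ∃ r : ℝ, S i i = (r : 𝕂))
    (V : Matrix (Fin d₂) (Fin (n + 1)) 𝕂) (hV : Vᴴ * V = 1)
    (hSVD : Qᴴ * A = Ut * S * Vᴴ)
    (j : Fin (n + 1))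
    (Qt : Matrix (Fin (n + 1)) (Fin n) 𝕂) (Rt : Matrix (Fin n) (Fin n) 𝕂)
    (hQt : Qtᴴ * Qt = 1) (hRttri : Rt.BlockTriangular id) (hRtinv : IsUnit Rt.det)
    (hQR' : (Matrix.of fun i k => R i (j.succAbove k) : Matrix (Fin (n + 1)) (Fin n) 𝕂)
      = Qt * Rt)
    (P : Matrix (Fin d₁) (Fin d₁) 𝕂)
    (hP : P.IsHermitian) (hPidem : P * P = P)
    (hPrange : LinearMap.range P.mulVecLin
      = LinearMap.range
          (Matrix.of fun i k => Y i (j.succAbove k) : Matrix (Fin d₁) (Fin n) 𝕂).mulVecLin) :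
    P * A = (Q * Ut) * (Utᴴ * Qt * Qtᴴ * Ut * S) * Vᴴ := by
  have hY' : (Matrix.of fun i k => Y i (j.succAbove k) : Matrix (Fin d₁) (Fin n) 𝕂)
      = Q * Qt * Rt := by
    rw [Matrix.mul_assoc, ← hQR', hYQR]
    ext i k
    simp [Matrix.mul_apply]
  rw [hY'] at hPrange
  have hW : (Q * Qt)ᴴ * (Q * Qt) = 1 := by
    rw [Matrix.conjTranspose_mul, Matrix.mul_assoc, ← Matrix.mul_assoc Qᴴ, hQ, Matrix.one_mul, hQt]
  generalize hWd : Q * Qt = W at *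
  have h1 : P * (W * Rt) = W * Rt := by
    apply Matrix.ext_of_mulVec_single
    intro i
    have hm : (W * Rt).mulVecLin (Pi.single i 1) ∈ LinearMap.range P.mulVecLin := by
      rw [hPrange]
      exact LinearMap.mem_range_self _ _
    obtain ⟨y, hy⟩ := hm
    simp only [Matrix.mulVecLin_apply] at hy
    rw [← Matrix.mulVec_mulVec, ← hy, Matrix.mulVec_mulVec, hPidem]
  have h2 : P * W = W := by
    have h := congrArg (fun M => M * Rt⁻¹) h1
    simp only [Matrix.mul_assoc, Matrix.mul_nonsing_inv Rt hRtinv, Matrix.mul_one] at h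
    exact h
  have h3 : W * Wᴴ * P = P := by
    apply Matrix.ext_of_mulVec_single
    intro i
    have hm : P.mulVecLin (Pi.single i 1) ∈ LinearMap.range (W * Rt).mulVecLin := by
      rw [← hPrange]
      exact LinearMap.mem_range_self _ _
    obtain ⟨y, hy⟩ := hm
    simp only [Matrix.mulVecLin_apply] at hy
    rw [← Matrix.mulVec_mulVec, ← hy, Matrix.mulVec_mulVec]
    congr 1
    rw [Matrix.mul_assoc, ← Matrix.mul_assoc Wᴴ, hW, Matrix.one_mul]
  have h4 : P = W * Wᴴ := by
    have h := congrArg Matrix.conjTranspose h3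
    rw [Matrix.conjTranspose_mul, Matrix.conjTranspose_mul, Matrix.conjTranspose_conjTranspose,
      hP.eq, ← Matrix.mul_assoc, h2] at h
    exact h.symm
  have hU : Ut * Utᴴ = 1 := mul_eq_one_comm.mp hUt
  calc P * A = Q * (Qt * (Qtᴴ * (Qᴴ * A))) := by
        rw [h4, ← hWd, Matrix.conjTranspose_mul]
        simp only [Matrix.mul_assoc]
    _ = Q * ((Ut * Utᴴ) * (Qt * (Qtᴴ * (Ut * S * Vᴴ)))) := by
        rw [hSVD, hU, Matrix.one_mul]
    _ = _ := by simp only [Matrix.mul_assoc]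
end

section
/- The Nyström approximation is a positive-semidefinite underestimate with positive-semidefinite residual: let A ∈ 𝕂^{d×d} be positive semidefinite and Ω ∈ 𝕂^{d×s} arbitrary, and define X := AΩ (Ω*AΩ)† (AΩ)*, where † denotes the Moore–Penrose pseudoinverse. Then X is positive semidefinite, A − X is positive semidefinite, and range(X) ⊆ range(AΩ). -/
open Matrix
open scoped ComplexOrder

/-- **The Nyström approximation is a positive-semidefinite underestimate with
positive-semidefinite residual.**
Let `A ∈ 𝕂^{d×d}` be positive semidefinite and `Ω ∈ 𝕂^{d×s}` arbitrary, and let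
`X := AΩ (Ω*AΩ)† (AΩ)*`, where the Moore–Penrose pseudoinverse `(Ω*AΩ)†` is characterized as
the (unique) matrix `Mp` satisfying the four Penrose conditions for `M := Ω*AΩ`.  Then `X` is
positive semidefinite, `A − X` is positive semidefinite, and `range X ⊆ range (AΩ)`. -/
theorem nystrom_psd_underestimate
    {𝕂 : Type*} [RCLike 𝕂] {d s : ℕ}
    (A : Matrix (Fin d) (Fin d) 𝕂) (hA : A.PosSemidef)
    (Om : Matrix (Fin d) (Fin s) 𝕂)
    (Mp : Matrix (Fin s) (Fin s) 𝕂)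
    (hMp1 : (Omᴴ * A * Om) * Mp * (Omᴴ * A * Om) = Omᴴ * A * Om)
    (hMp2 : Mp * (Omᴴ * A * Om) * Mp = Mp)
    (hMp3 : ((Omᴴ * A * Om) * Mp)ᴴ = (Omᴴ * A * Om) * Mp)
    (hMp4 : (Mp * (Omᴴ * A * Om))ᴴ = Mp * (Omᴴ * A * Om)) :
    ((A * Om) * Mp * (A * Om)ᴴ).PosSemidef ∧
    (A - (A * Om) * Mp * (A * Om)ᴴ).PosSemidef ∧
    LinearMap.range ((A * Om) * Mp * (A * Om)ᴴ).mulVecLin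
      ≤ LinearMap.range (A * Om).mulVecLin := by
  have hAH : Aᴴ = A := hA.1
  have hM : (Omᴴ * A * Om).PosSemidef := hA.conjTranspose_mul_mul_same Om
  have hP : Mpᴴ = Mp := by
    generalize Omᴴ * A * Om = M at *
    have hMH : Mᴴ = M := hM.1
    have h3 : Mpᴴ * M = M * Mp := by
      have h := hMp3
      rwa [conjTranspose_mul, hMH] at h
    have h4 : M * Mpᴴ = Mp * M := by
      have h := hMp4
      rwa [conjTranspose_mul, hMH] at h
    have h1 : M * Mpᴴ * M = M := by
      have h := congrArg conjTranspose hMp1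
      simpa [conjTranspose_mul, hMH, Matrix.mul_assoc] using h
    have h2 : Mpᴴ * M * Mpᴴ = Mpᴴ := by
      have h := congrArg conjTranspose hMp2
      simpa [conjTranspose_mul, hMH, Matrix.mul_assoc] using h
    have e1 : Mp * M * (M * Mp) = M * Mp := by
      rw [← h4, ← Matrix.mul_assoc, h1]
    have e2 : Mp * M * (M * Mp) = Mp * M := by
      rw [← h3, ← Matrix.mul_assoc, Matrix.mul_assoc Mp, Matrix.mul_assoc Mp, h1]
    have e : M * Mp = Mp * M := e1.symm.trans e2
    calc Mpᴴ = Mpᴴ * M * Mpᴴ := h2.symm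
      _ = M * Mp * Mpᴴ := by rw [h3]
      _ = Mp * (M * Mpᴴ) := by rw [e, Matrix.mul_assoc]
      _ = Mp * M * Mp := by rw [Matrix.mul_assoc, h4, e]
      _ = Mp := hMp2
  have hPs : Mp.PosSemidef := by
    have h := hM.conjTranspose_mul_mul_same Mp
    rwa [hP, hMp2] at h
  refine ⟨hPs.mul_mul_conjTranspose_same _, ?_, ?_⟩
  · have h := hA.conjTranspose_mul_mul_same (1 - Om * Mp * Omᴴ * A)
    convert h using 1
    have k : A * Om * Mp * Omᴴ * A * Om * Mp * Omᴴ * A = A * Om * Mp * Omᴴ * A := by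
      have := congrArg (fun Z => A * Om * Z * Omᴴ * A) hMp2
      simpa only [Matrix.mul_assoc] using this
    simp only [Matrix.mul_assoc] at k
    simp only [conjTranspose_sub, conjTranspose_mul, conjTranspose_conjTranspose,
      conjTranspose_one, hP, hAH, Matrix.sub_mul, Matrix.mul_sub, Matrix.mul_assoc,
      Matrix.one_mul, Matrix.mul_one, k]
    abel
  · rintro _ ⟨v, rfl⟩
    refine ⟨(Mp * (A * Om)ᴴ) *ᵥ v, ?_⟩
    simp only [mulVecLin_apply, mulVec_mulVec, Matrix.mul_assoc]
end

section
/- Correctness of the single-view Nyström eigendecomposition (section 4.1): let A ∈ 𝕂^{d×d} be positive semidefinite, let Ω ∈ 𝕂^{d×s}, set Y := AΩ, and assume B := Ω*Y is positive definite. Let Y = QR be an economy QR factorization (Q ∈ 𝕂^{d×s} with orthonormal columns, R ∈ 𝕂^{s×s} upper triangular), let B = C*C be a Cholesky factorization with C invertible, and let R C^{-1} = U Σ Z* be a singular value decomposition with U, Z ∈ 𝕂^{s×s} unitary and Σ ∈ ℝ^{s×s} diagonal. Then the Nyström approximation satisfies Y B^{-1} Y* = V Λ V*, where V := QU has orthonormal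 columns and Λ := Σ². -/
open Matrix
open scoped ComplexOrder

/-- **Correctness of the single-view Nyström eigendecomposition** (section 4.1).
Let `A ∈ 𝕂^{d×d}` be positive semidefinite, `Ω ∈ 𝕂^{d×s}`, set `Y := AΩ`, and assume
`B := Ω*Y` is positive definite.  Let `Y = QR` be an economy QR factorization (`Q` with
orthonormal columns, `R` upper triangular), `B = C*C` a Cholesky factorization with `C`
invertible (and upper triangular), and `R C⁻¹ = U Σ Z*` an SVD with `U, Z ∈ 𝕂^{s×s}` unitary
and `Σ` diagonal with real entries.  Then the Nyström approximation satisfies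
`Y B⁻¹ Y* = V Λ V*` where `V := QU` has orthonormal columns and `Λ := Σ²`. -/
theorem nystrom_eigendecomposition_correct
    {𝕂 : Type*} [RCLike 𝕂] {d s : ℕ}
    (A : Matrix (Fin d) (Fin d) 𝕂) (hA : A.PosSemidef)
    (Om : Matrix (Fin d) (Fin s) 𝕂)
    (hB : (Omᴴ * (A * Om)).PosDef)
    (Q : Matrix (Fin d) (Fin s) 𝕂) (R : Matrix (Fin s) (Fin s) 𝕂)
    (hQR : A * Om = Q * R) (hQ : Qᴴ * Q = 1) (hRtri : R.BlockTriangular id)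
    (C : Matrix (Fin s) (Fin s) 𝕂)
    (hChol : Omᴴ * (A * Om) = Cᴴ * C) (hCtri : C.BlockTriangular id) (hCinv : IsUnit C.det)
    (U Z : Matrix (Fin s) (Fin s) 𝕂) (hU : Uᴴ * U = 1) (hZ : Zᴴ * Z = 1)
    (S : Matrix (Fin s) (Fin s) 𝕂) (hSdiag : S.IsDiag)
    (hSreal : ∀ i, ∃ r : ℝ, S i i = (r : 𝕂))
    (hSVD : R * C⁻¹ = U * S * Zᴴ) :
    (A * Om) * (Omᴴ * (A * Om))⁻¹ * (A * Om)ᴴ = (Q * U) * (S * S) * (Q * U)ᴴ ∧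
    (Q * U)ᴴ * (Q * U) = 1 := by
  have hS : Sᴴ = S := by
    ext i j
    rw [conjTranspose_apply]
    by_cases h : i = j
    · subst h
      obtain ⟨r, hr⟩ := hSreal i
      rw [hr]
      exact RCLike.conj_ofReal r
    · rw [hSdiag h, hSdiag (Ne.symm h), star_zero]
  constructor
  · rw [hChol, hQR, Matrix.mul_inv_rev, ← conjTranspose_nonsing_inv]
    have h1 : Q * R * (C⁻¹ * C⁻¹ᴴ) * (Q * R)ᴴ = Q * ((R * C⁻¹) * (R * C⁻¹)ᴴ) * Qᴴ := by
      simp only [conjTranspose_mul, Matrix.mul_assoc]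
    have h2 : (U * S * Zᴴ) * (U * S * Zᴴ)ᴴ = U * (S * S) * Uᴴ := by
      have h3 : (U * S * Zᴴ) * (U * S * Zᴴ)ᴴ = U * S * (Zᴴ * Z) * (Sᴴ * Uᴴ) := by
        simp only [conjTranspose_mul, conjTranspose_conjTranspose, Matrix.mul_assoc]
      rw [h3, hZ, hS, Matrix.mul_one]
      simp only [Matrix.mul_assoc]
    rw [h1, hSVD, h2]
    simp only [conjTranspose_mul, Matrix.mul_assoc]
  · have h : (Q * U)ᴴ * (Q * U) = Uᴴ * (Qᴴ * Q) * U := by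
      simp only [conjTranspose_mul, Matrix.mul_assoc]
    rw [h, hQ, Matrix.mul_one, hU]
end

section
/- Correctness of the Nyström jackknife core matrices (Algorithm 4.1, line 14): in the setting of the single-view Nyström eigendecomposition (Y = AΩ = QR, B = Ω*Y positive definite, R C^{-1} = U Σ Z*, V = QU), fix j and let Ω_j be Ω with its j-th column deleted, R_j ∈ 𝕂^{s×(s-1)} be R with its j-th column deleted, and B_j ∈ 𝕂^{(s-1)×(s-1)} be B with its j-th row and j-th column deleted, assumed invertible. Then the jackknife replicate satisfies AΩ_j (Ω_j* A Ω_j)^{-1} (AΩ_j)* = V T_j V*, where T_j := U* R_j B_j^{-1} R_j* U. -/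
open Matrix
open scoped ComplexOrder

/-- **Correctness of the Nyström jackknife core matrices** (Algorithm 4.1, line 14).
In the setting of the single-view Nyström eigendecomposition (`A` positive semidefinite,
`Y := AΩ = QR` an economy QR factorization with `R` invertible, `B := Ω*Y = Ω*AΩ` positive
definite with Cholesky factorization `B = C*C`, `R C⁻¹ = U Σ Z*` an SVD with `U` unitary,
`V := QU`), fix `j` (here `s = n+1`) and let `Ω_j` be `Ω` with its `j`-th column deleted,
`R_j` be `R` with its `j`-th column deleted, and `B_j` be `B` with its `j`-th row and `j`-th
column deleted, assumed invertible.  Then the jackknife replicate satisfies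
`AΩ_j (Ω_j* A Ω_j)⁻¹ (AΩ_j)* = V T_j V*` where `T_j := U* R_j B_j⁻¹ R_j* U`. -/
theorem nystrom_core_matrix_correct
    {𝕂 : Type*} [RCLike 𝕂] {d n : ℕ}
    (A : Matrix (Fin d) (Fin d) 𝕂) (hA : A.PosSemidef)
    (Om : Matrix (Fin d) (Fin (n + 1)) 𝕂)
    (hB : (Omᴴ * (A * Om)).PosDef)
    (Q : Matrix (Fin d) (Fin (n + 1)) 𝕂) (R : Matrix (Fin (n + 1)) (Fin (n + 1)) 𝕂)
    (hQR : A * Om = Q * R) (hQ : Qᴴ * Q = 1) (hRtri : R.BlockTriangular id)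
    (hRinv : IsUnit R.det)
    (C : Matrix (Fin (n + 1)) (Fin (n + 1)) 𝕂)
    (hChol : Omᴴ * (A * Om) = Cᴴ * C) (hCtri : C.BlockTriangular id) (hCinv : IsUnit C.det)
    (U Z : Matrix (Fin (n + 1)) (Fin (n + 1)) 𝕂) (hU : Uᴴ * U = 1) (hZ : Zᴴ * Z = 1)
    (S : Matrix (Fin (n + 1)) (Fin (n + 1)) 𝕂) (hSdiag : S.IsDiag)
    (hSreal : ∀ i, ∃ r : ℝ, S i i = (r : 𝕂))
    (hSVD : R * C⁻¹ = U * S * Zᴴ)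
    (j : Fin (n + 1))
    (hBj : IsUnit (Matrix.of fun k l =>
      (Omᴴ * (A * Om)) (j.succAbove k) (j.succAbove l) : Matrix (Fin n) (Fin n) 𝕂).det) :
    (A * (Matrix.of fun i k => Om i (j.succAbove k) : Matrix (Fin d) (Fin n) 𝕂)) *
        ((Matrix.of fun i k => Om i (j.succAbove k) : Matrix (Fin d) (Fin n) 𝕂)ᴴ *
          (A * (Matrix.of fun i k => Om i (j.succAbove k) : Matrix (Fin d) (Fin n) 𝕂)))⁻¹ *
        (A * (Matrix.of fun i k => Om i (j.succAbove k) : Matrix (Fin d) (Fin n) 𝕂))ᴴ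
      = (Q * U) *
          (Uᴴ * (Matrix.of fun i k => R i (j.succAbove k) : Matrix (Fin (n + 1)) (Fin n) 𝕂) *
            (Matrix.of fun k l =>
              (Omᴴ * (A * Om)) (j.succAbove k) (j.succAbove l) : Matrix (Fin n) (Fin n) 𝕂)⁻¹ *
            (Matrix.of fun i k => R i (j.succAbove k) : Matrix (Fin (n + 1)) (Fin n) 𝕂)ᴴ * U) *
          (Q * U)ᴴ := by
  have h1 : A * (Matrix.of fun i k => Om i (j.succAbove k) : Matrix (Fin d) (Fin n) 𝕂)
      = Q * (Matrix.of fun i k => R i (j.succAbove k) : Matrix (Fin (n + 1)) (Fin n) 𝕂) := by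
    ext i k
    have h := congrFun (congrFun hQR i) (j.succAbove k)
    simpa only [Matrix.mul_apply, Matrix.of_apply] using h
  have h2 : (Matrix.of fun i k => Om i (j.succAbove k) : Matrix (Fin d) (Fin n) 𝕂)ᴴ *
      (A * (Matrix.of fun i k => Om i (j.succAbove k) : Matrix (Fin d) (Fin n) 𝕂))
      = (Matrix.of fun k l =>
          (Omᴴ * (A * Om)) (j.succAbove k) (j.succAbove l) : Matrix (Fin n) (Fin n) 𝕂) := by
    ext k l
    simp only [Matrix.mul_apply, Matrix.of_apply, Matrix.conjTranspose_apply]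
  have hU2 : U * Uᴴ = 1 := mul_eq_one_comm.mp hU
  rw [h2, h1]
  generalize (Matrix.of fun k l =>
    (Omᴴ * (A * Om)) (j.succAbove k) (j.succAbove l) : Matrix (Fin n) (Fin n) 𝕂)⁻¹ = M
  generalize (Matrix.of fun i k => R i (j.succAbove k) : Matrix (Fin (n + 1)) (Fin n) 𝕂) = P
  have h3 : (Q * U) * (Uᴴ * P * M * Pᴴ * U) * (Q * U)ᴴ
      = Q * ((U * Uᴴ) * P * M * Pᴴ * (U * Uᴴ)) * Qᴴ := by
    simp only [Matrix.conjTranspose_mul, Matrix.mul_assoc]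
  rw [h3, hU2]
  simp only [Matrix.conjTranspose_mul, Matrix.mul_assoc, Matrix.one_mul, Matrix.mul_one]
end
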